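/- Let α ∈ (1,2), n ≥ 1 an integer, w > 0, and set A_n = w·G_n^{(α)} and P_n = w·τ(G_n^{(α)}). If λ, μ ∈ ℝ and z, y ∈ ℝⁿ are nonzero vectors with A_n·z = λ·P_n·z and A_n·y = μ·P_n·y, then μ > 0 and λ/μ < 3; that is, the spectral condition number of P_n^{−1}·A_n is less than 3. -/

import Mathlib

/-- Grünwald–Letnikov coefficients: `g 0 = 1`, `g k = (1 - (α+1)/k) * g (k-1)` for `k ≥ 1`. -/
noncomputable def glCoef (α : ℝ) : ℕ → ℝ
  | 0 => 1
  | k + 1 => (1 - (α + 1) / ((k : ℝ) + 1)) * glCoef α k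

/-- First-column entries of `G_n^{(α)}`: `t_0 = -2g_1`, `t_1 = -(g_0+g_2)`, `t_k = -g_{k+1}` for `k ≥ 2`. -/
noncomputable def tC (α : ℝ) : ℕ → ℝ
  | 0 => -2 * glCoef α 1
  | 1 => -(glCoef α 0 + glCoef α 2)
  | k + 2 => -glCoef α (k + 3)

/-- Padded coefficients: `t_k` for `k < n`, `0` for `k ≥ n`. -/
noncomputable def tpad (n : ℕ) (t : ℕ → ℝ) (k : ℕ) : ℝ := if k < n then t k else 0

/-- The `n×n` symmetric Toeplitz matrix with `(i,j)` entry `t_{|i-j|}`. -/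
noncomputable def toeplitzM (n : ℕ) (t : ℕ → ℝ) : Matrix (Fin n) (Fin n) ℝ :=
  fun i j => t (Nat.dist i.val j.val)

/-- The Hankel matrix `(H_n)_{ij} = t_{i+j} + t_{2(n+1)-(i+j)}` (1-based indices,
with the convention `t_k = 0` for `k ≥ n`). Here `i j : Fin n` are 0-based. -/
noncomputable def hankelM (n : ℕ) (t : ℕ → ℝ) : Matrix (Fin n) (Fin n) ℝ :=
  fun i j => tpad n t (i.val + j.val + 2) + tpad n t (2 * n - (i.val + j.val))

/-- The τ-matrix `τ(T_n) = T_n - H_n`. -/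
noncomputable def tauM (n : ℕ) (t : ℕ → ℝ) : Matrix (Fin n) (Fin n) ℝ :=
  toeplitzM n t - hankelM n t

/-- The matrix `G_n^{(α)}`. -/
noncomputable def Gmat (α : ℝ) (n : ℕ) : Matrix (Fin n) (Fin n) ℝ := toeplitzM n (tC α)

open Finset in
/-- If `A` is strictly diagonally dominant with margin exceeding twice the absolute row sums of `B`,
then every generalized eigenvalue of `B` with respect to `A` is less than `1/2` in modulus. -/
theorem abs_lt_half_of_mulVec_eq_smul {ι : Type*} [Fintype ι] [DecidableEq ι]
    (A B : Matrix ι ι ℝ)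
    (hAB : ∀ k, 2 * ∑ j, |B k j| < A k k - ∑ j ∈ univ.erase k, |A k j|)
    {c : ℝ} {z : ι → ℝ} (hz : z ≠ 0) (h : B.mulVec z = c • A.mulVec z) : |c| < 1 / 2 := by
  obtain ⟨i, hi⟩ := Function.ne_iff.mp hz
  obtain ⟨k, -, hk⟩ := exists_max_image univ (fun j => |z j|) ⟨i, mem_univ i⟩
  have hpos : 0 < |z k| := (abs_pos.mpr hi).trans_le (hk i (mem_univ i))
  have hB : |B.mulVec z k| ≤ (∑ j, |B k j|) * |z k| := by
    rw [Matrix.mulVec, dotProduct, sum_mul]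
    refine (abs_sum_le_sum_abs _ _).trans (sum_le_sum fun j hj => ?_)
    rw [abs_mul]
    exact mul_le_mul_of_nonneg_left (hk j hj) (abs_nonneg _)
  have hA : (A k k - ∑ j ∈ univ.erase k, |A k j|) * |z k| ≤ |A.mulVec z k| := by
    have hoff : |∑ j ∈ univ.erase k, A k j * z j| ≤ (∑ j ∈ univ.erase k, |A k j|) * |z k| := by
      rw [sum_mul]
      refine (abs_sum_le_sum_abs _ _).trans (sum_le_sum fun j _ => ?_)
      rw [abs_mul]
      exact mul_le_mul_of_nonneg_left (hk j (mem_univ j)) (abs_nonneg _)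
    have hdiag : A k k * |z k| ≤ |A k k * z k| := by
      rw [abs_mul]
      exact mul_le_mul_of_nonneg_right (le_abs_self _) hpos.le
    rw [Matrix.mulVec, dotProduct, ← add_sum_erase univ _ (mem_univ k), sub_mul]
    have := abs_sub_abs_le_abs_add (A k k * z k) (∑ j ∈ univ.erase k, A k j * z j)
    linarith
  have hk' : |B.mulVec z k| = |c| * |A.mulVec z k| := by
    rw [h, Pi.smul_apply, smul_eq_mul, abs_mul]
  have hS : 0 ≤ ∑ j, |B k j| := sum_nonneg fun _ _ => abs_nonneg _
  set D := A k k - ∑ j ∈ univ.erase k, |A k j|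
  have hD : 2 * ∑ j, |B k j| < D := hAB k
  have h1 : |c| * (D * |z k|) ≤ (∑ j, |B k j|) * |z k| :=
    (mul_le_mul_of_nonneg_left hA (abs_nonneg c)).trans (hk' ▸ hB)
  have h2 : |c| * D ≤ ∑ j, |B k j| := by
    rw [← mul_assoc] at h1
    exact le_of_mul_le_mul_right h1 hpos
  by_contra! hc
  nlinarith [mul_le_mul_of_nonneg_right hc (by linarith : (0 : ℝ) ≤ D)]

open Finset in
theorem sum_range_sub_add_sum_range_add_le {f : ℕ → ℝ} {n k : ℕ} (hf : ∀ m, 0 ≤ f m)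
    (h0 : f 0 = 0) (hn : ∀ m, n ≤ m → f m = 0) (hk : k < n) :
    ∑ j ∈ range n, f (k - j) + ∑ j ∈ range n, f (k + j + 2) ≤ ∑ m ∈ range n, f m := by
  have h1 : ∑ j ∈ range n, f (k - j) = ∑ m ∈ range (k + 1), f m := by
    rw [← sum_range_reflect f (k + 1)]
    symm
    refine (sum_subset (range_subset_range.2 hk) fun j _ hj => ?_).trans ?_
    · rw [mem_range, not_lt] at hj
      rw [show k + 1 - 1 - j = 0 by omega, h0]
    · simp
  have h2 : ∑ j ∈ range n, f (k + j + 2) ≤ ∑ j ∈ range (n + 1), f (k + 1 + j) := by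
    rw [sum_range_succ']
    refine le_add_of_le_of_nonneg (sum_le_sum fun j _ => ?_) (hf _)
    rw [show k + j + 2 = k + 1 + (j + 1) by ring]
  have h3 : ∑ m ∈ range n, f m = ∑ m ∈ range (k + 1 + (n + 1)), f m :=
    sum_subset (range_subset_range.2 (by omega)) fun m _ hm => hn m (by simpa using hm)
  rw [h3, sum_range_add, h1]
  gcongr

open Finset in
theorem sum_range_dist_add_hankel_le {f : ℕ → ℝ} {n k : ℕ} (hf : ∀ m, 0 ≤ f m)
    (h0 : f 0 = 0) (hn : ∀ m, n ≤ m → f m = 0) (hk : k < n) :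
    ∑ j ∈ range n, (f (Nat.dist k j) + (f (k + j + 2) + f (2 * n - (k + j)))) ≤
      2 * ∑ m ∈ range n, f m := by
  have h1 := sum_range_sub_add_sum_range_add_le hf h0 hn hk
  have h2 := sum_range_sub_add_sum_range_add_le hf h0 hn (show n - 1 - k < n by omega)
  rw [← sum_range_reflect (fun j => f (n - 1 - k - j)),
    ← sum_range_reflect (fun j => f (n - 1 - k + j + 2)), ← sum_add_distrib] at h2
  rw [← sum_add_distrib] at h1
  refine le_trans (le_of_eq ?_) ((add_le_add h1 h2).trans_eq (two_mul _).symm)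
  rw [← sum_add_distrib]
  refine sum_congr rfl fun j hj => ?_
  rw [mem_range] at hj
  rw [show n - 1 - k - (n - 1 - j) = j - k by omega,
    show n - 1 - k + (n - 1 - j) + 2 = 2 * n - (k + j) by omega]
  rcases le_total k j with h | h
  · rw [Nat.dist_eq_sub_of_le h, Nat.sub_eq_zero_of_le h, h0]
    ring
  · rw [Nat.dist_eq_sub_of_le_right h, Nat.sub_eq_zero_of_le h, h0]
    ring

open Finset in
theorem two_mul_sum_abs_hankelM_lt {n : ℕ} {t : ℕ → ℝ} (ht : ∀ m, t (m + 1) ≤ 0)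
    (hmono : Monotone fun m => t (m + 1))
    (hsum : 2 * ∑ i ∈ range (n - 1), -t (i + 1) < t 0) (k : Fin n) :
    2 * ∑ j, |hankelM n t k j| <
      tauM n t k k - ∑ j ∈ univ.erase k, |tauM n t k j| := by
  obtain ⟨f, hfdef⟩ : ∃ f : ℕ → ℝ, f = fun m => if m = 0 then 0 else -tpad n t m := ⟨_, rfl⟩
  have hkn := k.2
  have hfpos : ∀ m, m ≠ 0 → tpad n t m = -f m := fun m hm => by simp [hfdef, hm]
  have hf0 : f 0 = 0 := by simp [hfdef]
  have hfn : ∀ m, n ≤ m → f m = 0 := fun m hm => by simp [hfdef, tpad, not_lt.2 hm]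
  have hft : ∀ m, m < n → m ≠ 0 → t m = -f m := fun m hm h0 => by
    simp [hfdef, tpad, hm, h0]
  have hf : ∀ m, 0 ≤ f m := by
    intro m
    rcases m with _ | m
    · exact hf0.ge
    · rcases lt_or_ge (m + 1) n with h | h
      · linarith [hft (m + 1) h (by omega), ht m]
      · exact (hfn _ h).ge
  have hfanti : ∀ a b, a ≠ 0 → a ≤ b → f b ≤ f a := by
    intro a b ha hab
    rcases lt_or_ge b n with h | h
    · obtain ⟨a, rfl⟩ := Nat.exists_eq_succ_of_ne_zero ha
      obtain ⟨b, rfl⟩ := Nat.exists_eq_succ_of_ne_zero (show b ≠ 0 by omega)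
      have := hmono (show a ≤ b by omega)
      simp only at this
      linarith [hft (a + 1) (by omega) (by omega), hft (b + 1) h (by omega)]
    · exact (hfn _ h).trans_le (hf a)
  have hfsum : 2 * ∑ m ∈ range n, f m < t 0 := by
    refine lt_of_eq_of_lt ?_ hsum
    obtain ⟨n, rfl⟩ := Nat.exists_eq_succ_of_ne_zero (show n ≠ 0 by omega)
    rw [sum_range_succ', hf0, add_zero, Nat.succ_sub_one]
    congr 1
    refine sum_congr rfl fun i hi => ?_
    rw [mem_range] at hi
    rw [hft (i + 1) (by omega) (by omega), neg_neg]
  have hrow := (sum_range_dist_add_hankel_le hf hf0 hfn hkn).trans_lt hfsum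
  have hH : ∀ j : Fin n, hankelM n t k j =
      -(f (k + j + 2) + f (2 * n - (k + j))) := by
    intro j
    have := j.2
    rw [hankelM, hfpos _ (by omega), hfpos _ (by omega)]
    ring
  rw [← Fin.sum_univ_eq_sum_range
    (fun j => f (Nat.dist k j) + (f (k + j + 2) + f (2 * n - (k + j)))), sum_add_distrib] at hrow
  have hHabs : ∀ j : Fin n, |hankelM n t k j| = f (k + j + 2) + f (2 * n - (k + j)) := by
    intro j
    rw [hH, abs_neg, abs_of_nonneg (add_nonneg (hf _) (hf _))]
  have hdiag : tauM n t k k = t 0 + (f (k + k + 2) + f (2 * n - (k + k))) := by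
    simp only [tauM, Matrix.sub_apply, hH, toeplitzM, Nat.dist_self]
    ring
  have hoff : ∀ j ∈ univ.erase k, |tauM n t k j| ≤
      f (Nat.dist k j) - (f (k + j + 2) + f (2 * n - (k + j))) := by
    intro j hj
    have hjn := j.2
    have hjk : (k : ℕ) ≠ j := fun h => (mem_erase.1 hj).1 (Fin.ext h).symm
    have hd0 : Nat.dist k j ≠ 0 := fun h => hjk (Nat.eq_of_dist_eq_zero h)
    have hdn : Nat.dist k j < n := by unfold Nat.dist; omega
    have hle : f (k + j + 2) + f (2 * n - (k + j)) ≤ f (Nat.dist k j) := by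
      rcases le_total n (k + j + 2) with h | h
      · rw [hfn _ h, zero_add]
        exact hfanti _ _ hd0 (by unfold Nat.dist; omega)
      · rw [hfn (2 * n - (k + j)) (by omega), add_zero]
        exact hfanti _ _ hd0 (by unfold Nat.dist; omega)
    simp only [tauM, Matrix.sub_apply, hH, toeplitzM]
    rw [hft _ hdn hd0, abs_of_nonpos (by linarith)]
    linarith
  have hoffsum := sum_le_sum hoff
  have hsplit := add_sum_erase univ
    (fun j : Fin n => f (Nat.dist k j) - (f (k + j + 2) + f (2 * n - (k + j)))) (mem_univ k)
  simp only [Nat.dist_self, hf0, sum_sub_distrib] at hsplit hoffsum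
  simp only [hHabs, hdiag]
  linarith

theorem glCoef_one (α : ℝ) : glCoef α 1 = -α := by
  simp [glCoef]

theorem glCoef_two (α : ℝ) : glCoef α 2 = α * (α - 1) / 2 := by
  simp only [glCoef]
  push_cast
  ring

theorem glCoef_pos {α : ℝ} (h1 : 1 < α) (h2 : α < 2) (k : ℕ) : 0 < glCoef α (k + 2) := by
  induction k with
  | zero =>
    rw [zero_add, glCoef_two]
    nlinarith
  | succ k ih =>
    rw [glCoef]
    refine mul_pos ?_ ih
    rw [sub_pos, div_lt_one (by positivity)]
    push_cast
    linarith [(Nat.cast_nonneg k : (0 : ℝ) ≤ k)]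

theorem glCoef_neg {β : ℝ} (h0 : 0 < β) (h1 : β < 1) (k : ℕ) : glCoef β (k + 1) < 0 := by
  induction k with
  | zero => simpa [glCoef_one] using h0
  | succ k ih =>
    rw [glCoef]
    refine mul_neg_of_pos_of_neg ?_ ih
    rw [sub_pos, div_lt_one (by positivity)]
    push_cast
    linarith [(Nat.cast_nonneg k : (0 : ℝ) ≤ k)]

theorem sum_glCoef (α : ℝ) (n : ℕ) :
    ∑ k ∈ Finset.range (n + 1), glCoef α k = glCoef (α - 1) n := by
  suffices h : ∑ k ∈ Finset.range (n + 1), glCoef α k = glCoef (α - 1) n ∧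
      ((n : ℝ) + 1) * glCoef α (n + 1) = -α * glCoef (α - 1) n from h.1
  induction n with
  | zero => simp [glCoef]
  | succ n ih =>
    obtain ⟨ih1, ih2⟩ := ih
    have hn : (n : ℝ) + 1 ≠ 0 := by positivity
    have hn' : (n : ℝ) + 1 + 1 ≠ 0 := by positivity
    have hg : glCoef α (n + 1) = -α * glCoef (α - 1) n / (n + 1) := by
      rw [← ih2]
      field_simp
    have hs : glCoef (α - 1) (n + 1) = (1 - α / (n + 1)) * glCoef (α - 1) n := by
      rw [glCoef, sub_add_cancel]
    refine ⟨?_, ?_⟩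
    · rw [Finset.sum_range_succ, ih1, hg, hs]
      ring
    · rw [glCoef, hg, hs]
      push_cast
      field_simp
      ring

theorem sum_neg_tC (α : ℝ) (n : ℕ) :
    ∑ i ∈ Finset.range (n + 1), -tC α (i + 1) = glCoef (α - 1) (n + 2) - glCoef α 1 := by
  rw [← sum_glCoef, Finset.sum_range_succ', Finset.sum_range_succ' _ (n + 2),
    Finset.sum_range_succ' _ (n + 1), Finset.sum_range_succ' _ n]
  simp only [tC, neg_neg]
  ring

theorem tC_succ_nonpos {α : ℝ} (h1 : 1 < α) (h2 : α < 2) (m : ℕ) : tC α (m + 1) ≤ 0 := by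
  rcases m with _ | m
  · have := glCoef_pos h1 h2 0
    simp only [tC, glCoef] at this ⊢
    linarith
  · have := glCoef_pos h1 h2 (m + 1)
    simp only [tC]
    linarith

theorem monotone_tC_succ {α : ℝ} (h1 : 1 < α) (h2 : α < 2) :
    Monotone fun m => tC α (m + 1) := by
  have hdec : ∀ k, glCoef α (k + 3) ≤ glCoef α (k + 2) := fun k => by
    rw [glCoef]
    refine mul_le_of_le_one_left (glCoef_pos h1 h2 k).le ?_
    rw [sub_le_self_iff]
    positivity
  refine monotone_nat_of_le_succ fun m => ?_
  rcases m with _ | m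
  · have := hdec 0
    have h0 : glCoef α 0 = 1 := rfl
    simp only [zero_add, tC] at this ⊢
    linarith
  · simpa only [tC, neg_le_neg_iff] using hdec (m + 1)

theorem two_mul_sum_neg_tC_lt {α : ℝ} (h1 : 1 < α) (h2 : α < 2) (n : ℕ) :
    2 * ∑ i ∈ Finset.range n, -tC α (i + 1) < tC α 0 := by
  rcases n with _ | n
  · simp only [Finset.range_zero, Finset.sum_empty, tC, glCoef_one]
    linarith
  · have := glCoef_neg (β := α - 1) (by linarith) (by linarith) (n + 1)
    rw [sum_neg_tC, tC]
    linarith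

theorem abs_sub_one_lt_half_of_Gmat_mulVec_eq {α : ℝ} (h1 : 1 < α) (h2 : α < 2) {n : ℕ}
    {w : ℝ} (hw : 0 < w) {c : ℝ} {z : Fin n → ℝ} (hz : z ≠ 0)
    (h : (w • Gmat α n).mulVec z = c • (w • tauM n (tC α)).mulVec z) : |c - 1| < 1 / 2 := by
  refine abs_lt_half_of_mulVec_eq_smul (tauM n (tC α)) (hankelM n (tC α))
    (two_mul_sum_abs_hankelM_lt (tC_succ_nonpos h1 h2) (monotone_tC_succ h1 h2)
      (two_mul_sum_neg_tC_lt h1 h2 _)) hz ?_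
  rw [Matrix.smul_mulVec, Matrix.smul_mulVec, smul_comm c w] at h
  have h' := smul_right_injective _ hw.ne' h
  have hG : hankelM n (tC α) = Gmat α n - tauM n (tC α) := by
    rw [Gmat, tauM, sub_sub_cancel]
  rw [hG, Matrix.sub_mulVec, sub_smul, one_smul]
  exact congrArg (· - (tauM n (tC α)).mulVec z) h'

theorem cond_number_lt_three (α : ℝ) (hα : α ∈ Set.Ioo (1 : ℝ) 2) (n : ℕ) (hn : 1 ≤ n)
    (w : ℝ) (hw : 0 < w) (lam mu : ℝ) (z y : Fin n → ℝ) (hz : z ≠ 0) (hy : y ≠ 0)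
    (h1 : (w • Gmat α n).mulVec z = lam • (w • tauM n (tC α)).mulVec z)
    (h2 : (w • Gmat α n).mulVec y = mu • (w • tauM n (tC α)).mulVec y) :
    0 < mu ∧ lam / mu < 3 := by
  obtain ⟨hα1, hα2⟩ := hα
  have hlam := abs_lt.1 (abs_sub_one_lt_half_of_Gmat_mulVec_eq hα1 hα2 hw hz h1)
  have hmu := abs_lt.1 (abs_sub_one_lt_half_of_Gmat_mulVec_eq hα1 hα2 hw hy h2)
  have hpos : 0 < mu := by linarith [hmu.1]
  refine ⟨hpos, ?_⟩
  rw [div_lt_iff₀ hpos]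
  linarith [hlam.2, hmu.1]
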